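/- Let σ be one of the five sign patterns (+,+,−,+,−,−,−,+,+), (+,+,−,+,−,+,−,−,+), (+,+,+,−,−,+,−,+,+), (+,+,+,+,−,+,−,−,+), (+,+,−,+,−,−,−,−,+). If there exists a monic real polynomial P of degree 8 that defines σ, has no negative real roots, and has exactly four positive real roots, each simple, then there exists a monic real polynomial U of degree 8 of the form U(x) = (x−1)^4 V(x), where V is a monic real polynomial of degree 4 with no real roots, such that U defines the sign pattern σ. -/

import Mathlib

open Polynomial

/-- A degree-8 real polynomial `P` defines the sign pattern `σ = (σ_0, …, σ_8)`
(with entries `1` for `+`, `-1` for `−`) if for each `j` the coefficient of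
`x^(8-j)` is nonzero and has sign `σ_j`. -/
def definesSignPattern (P : Polynomial ℝ) (σ : Fin 9 → ℝ) : Prop :=
  ∀ j : Fin 9, Real.sign (P.coeff (8 - (j : ℕ))) = σ j


lemma eight_esymm_two_le (p q r s : ℝ) : 8 * (p*q+p*r+p*s+q*r+q*s+r*s) ≤ 3 * (p+q+r+s)^2 := by
  linarith [sq_nonneg (p-q), sq_nonneg (p-r), sq_nonneg (p-s), sq_nonneg (q-r), sq_nonneg (q-s), sq_nonneg (r-s)]

lemma nine_esymm_one_mul_three_le (p q r s : ℝ) : 9 * ((p+q+r+s)*(p*q*r+p*q*s+p*r*s+q*r*s)) ≤ 4 * (p*q+p*r+p*s+q*r+q*s+r*s)^2 := by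
  linarith [sq_nonneg (p*q-p*r), sq_nonneg (p*q-p*s), sq_nonneg (p*r-p*s), sq_nonneg (p*q-q*r), sq_nonneg (p*q-q*s), sq_nonneg (q*r-q*s), sq_nonneg (p*r-q*r), sq_nonneg (p*r-r*s), sq_nonneg (q*r-r*s), sq_nonneg (p*s-q*s), sq_nonneg (p*s-r*s), sq_nonneg (q*s-r*s),
   sq_nonneg (p*q-r*s), sq_nonneg (p*r-q*s), sq_nonneg (p*s-q*r)]

lemma eight_esymm_two_mul_four_le (p q r s : ℝ) : 8 * ((p*q+p*r+p*s+q*r+q*s+r*s)*(p*q*r*s)) ≤ 3 * (p*q*r+p*q*s+p*r*s+q*r*s)^2 := by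
  linarith [eight_esymm_two_le (p*q*r) (p*q*s) (p*r*s) (q*r*s)]

lemma three_esymm_one_mul_three_le (p q r s : ℝ) : 3 * ((p+q+r+s)*(p*q*r+p*q*s+p*r*s+q*r*s)) ≤ (p*q+p*r+p*s+q*r+q*s+r*s)^2 + 12 * (p*q*r*s) := by
  linarith [sq_nonneg ((p-q)*(r-s)), sq_nonneg ((p-r)*(q-s)), sq_nonneg ((p-s)*(q-r))]

lemma sub_le_of_newton {s m q : ℝ} (hs : 8/3 ≤ s) (hm' : 9*m ≤ 4*s) (hq : 0 < q) :
    m - q ≤ (s-1)*(s-m) := by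
  nlinarith [mul_nonneg (sub_nonneg.2 hs) (sub_nonneg.2 hm')]

lemma mul_le_sq_add_of_newton {s m q : ℝ} (hs : 8/3 ≤ s) (hm : 0 < m) (hm' : 9*m ≤ 4*s) (hq : 0 < q)
    (hI : 3*(s*m) ≤ s^2+12*q) :
    (s-1)*(s-m)*(m-q) ≤ ((s-1)*(s-m)-(m-q))^2 + (s-1)^3*q := by
  obtain ⟨p, rfl⟩ : ∃ p, s = 8/3+p := ⟨s-8/3, by ring⟩
  have hp : 0 ≤ p := by linarith
  have hX : 0 ≤ (8/3+p-1)*(8/3+p-m)-m := by nlinarith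
  have key : 0 ≤ ((8/3+p-1)*(8/3+p-m)-m)^2 - (8/3+p-1)*(8/3+p-m)*m + q*(2*((8/3+p-1)*(8/3+p-m)-m) + (8/3+p-1)^3 + (8/3+p-1)*(8/3+p-m)) := by
    have hY : 0 ≤ 2*((8/3+p-1)*(8/3+p-m)-m) + (8/3+p-1)^3 + (8/3+p-1)*(8/3+p-m) := by
      have : 0 ≤ (8/3+p-1)*(8/3+p-m) := by apply mul_nonneg <;> linarith
      have : 0 ≤ (8/3+p-1)^3 := pow_nonneg (by linarith) 3
      linarith
    rcases le_total (3*m) (8/3+p) with h | h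
    · have h1 : 10/3*m ≤ (8/3+p-1)*(8/3+p-m) := by nlinarith
      have := mul_nonneg hq.le hY
      nlinarith
    · obtain ⟨t, rfl⟩ : ∃ t, m = (8/3+p)*(1/3+t) := ⟨m/(8/3+p)-1/3, by field_simp; ring⟩
      have ht : 0 ≤ t := by nlinarith
      have ht' : t ≤ 1/9 := by nlinarith
      have hq2 : (8/3+p)^2*t/4 ≤ q := by nlinarith
      have := mul_le_mul_of_nonneg_right hq2 hY
      refine le_trans ?_ (add_le_add_right this _)
      have g : 0 ≤ ((5/3+p)*(2/3-t)-(1/3+t))^2 - (5/3+p)*(2/3-t)*(1/3+t) + (t/4)*((8/3+p)*(2*((5/3+p)*(2/3-t)-(1/3+t)) + (5/3+p)*(2/3-t)) + (5/3+p)^3) := by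
        have c0 : 0 ≤ 19/81 - 191/108*t + 37/9*t^2 := by nlinarith
        have c1 : 0 ≤ p*((2/3-t)*(11/9-19/3*t)) :=
          mul_nonneg hp (mul_nonneg (by linarith) (by linarith))
        have c2 : 0 ≤ t*p*(2*((5/3)*(2/3-t)-(1/3+t)) + (5/3)*(2/3-t)) :=
          mul_nonneg (mul_nonneg ht hp) (by linarith)
        have c3 : 0 ≤ t*p*(2/3-t) := mul_nonneg (mul_nonneg ht hp) (by linarith)
        have c4 : 0 ≤ p^2*t*(2/3-t) := mul_nonneg (by positivity) (by linarith)
        have c5 : 0 ≤ p^2*(2/3-t)^2 := by positivity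
        have c6 : 0 ≤ t*p := by positivity
        have c7 : 0 ≤ t*p^2 := by positivity
        have c8 : 0 ≤ t*p^3 := by positivity
        linarith
      have := mul_nonneg (sq_nonneg (8/3+p)) g
      nlinarith
  nlinarith [sq_nonneg q]

lemma bounds_of_newton {s t q : ℝ} (hs : 0 < s) (hts : 9*s ≤ 4*t) (hst : 8*t ≤ 3*s^2) (hq : 0 < q) (hqt : 8*q ≤ 3*t) :
    13/32*(s*t) ≤ (t-s)*(t-q) - (s-1)*q ∧ 11/24*s^2 ≤ (s-1)^2-(t-s) ∧
    (t-q)^2 ≤ ((t-s)*(t-q) - (s-1)*q)*((s-1)^2-(t-s)) := by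
  have h6 : 6 ≤ s := by nlinarith
  have h1 : 13/32*(s*t) ≤ (t-s)*(t-q) - (s-1)*q := by
    nlinarith [mul_nonneg (sub_nonneg.2 hts) (sub_nonneg.2 hqt), mul_nonneg hs.le (sub_nonneg.2 hqt)]
  have h2 : 11/24*s^2 ≤ (s-1)^2-(t-s) := by nlinarith
  refine ⟨h1, h2, ?_⟩
  have ht : 0 < t := by linarith
  have h3 := mul_le_mul h1 h2 (by positivity) (le_trans (by positivity) h1)
  have h4 : t * (8*t) ≤ t*(3*s^2) := mul_le_mul_of_nonneg_left hst ht.le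
  have h5 : (t*s^2)*6 ≤ (t*s^2)*s := mul_le_mul_of_nonneg_left h6 (by positivity)
  nlinarith [mul_pos hq ht]

/-- No quartic `x⁴ + ax³ + bx² + cx + d`, positive at `-1`, multiplied by
`x⁴ - sx³ + sx² - mx + q` with Newton-type bounds on `s, m, q`, yields positive coefficients of
`x⁷, x⁵` and negative coefficients of `x⁴, x²`. -/
lemma false_of_a2_a4_neg_a5_a7_pos_of_normalized {s m q a b c d : ℝ} (hs : 8/3 ≤ s) (hm : 0 < m) (hm' : 9*m ≤ 4*s) (hq : 0 < q) (hqm : q ≤ m)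
    (hI : 3*(s*m) ≤ s^2+12*q) (h7 : 0 < a - s) (h5 : 0 < c - s*b+s*a-m)
    (h4 : d - s*c+s*b-m*a+q < 0) (h2 : s*d-m*c+q*b < 0) (hV : 0 < 1-a+b-c+d) : False := by
  have hA := sub_le_of_newton hs hm' hq
  have hB := mul_le_sq_add_of_newton hs hm hm' hq hI
  have A0 : 0 < s-1 := by linarith
  have B0 : 0 < s-m := by linarith
  have C0 : 0 ≤ m-q := by linarith
  have k2 := mul_neg_of_pos_of_neg (pow_pos A0 2) h2
  have k4 : 0 ≤ ((s-1)*(s-m)-(m-q))*(-(d - s*c+s*b-m*a+q)) :=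
    mul_nonneg (by linarith) (by linarith)
  have k5 := mul_nonneg (mul_nonneg C0 A0.le) h5.le
  have k7 := mul_nonneg (add_nonneg (mul_nonneg (sub_nonneg.2 hA) B0.le) (mul_nonneg (pow_pos A0 2).le hq.le)) h7.le
  have kV : 0 < ((s-1)*(s-m)-(m-q) + (s-1)^2*s)*(1-a+b-c+d) :=
    mul_pos (by have : 0 < (s-1)^2*s := by positivity
                linarith) hV
  linarith

/-- No quartic `x⁴ + ax³ + bx² + cx + d`, positive at `-1`, multiplied by
`x⁴ - sx³ + tx² - tx + q` with Newton-type bounds on `s, t, q`, yields positive coefficients of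
`x⁷, x⁶, x` and a negative coefficient of `x⁴`. -/
lemma false_of_a4_neg_a1_a6_a7_pos_of_normalized {s t q a b c d : ℝ} (hs : 0 < s) (hts : 9*s ≤ 4*t) (hst : 8*t ≤ 3*s^2) (hq : 0 < q) (hqt : 8*q ≤ 3*t)
    (h7 : 0 < a - s) (h6 : 0 < b - s*a+t)
    (h4 : d - s*c+t*b-t*a+q < 0) (h1 : 0 < -t*d+q*c) (hV : 0 < 1-a+b-c+d) : False := by
  obtain ⟨i1, i2, i3⟩ := bounds_of_newton hs hts hst hq hqt
  have h6s : 6 ≤ s := by nlinarith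
  have A0 : 0 < s-1 := by linarith
  have G0 : 0 ≤ (t-s)*(t-q) - (s-1)*q := le_trans (mul_nonneg (by norm_num) (mul_nonneg hs.le (by linarith))) i1
  have k1 := mul_pos A0 h1
  have k4 : 0 ≤ (t-q)*(-(d - s*c+t*b-t*a+q)) := mul_nonneg (by linarith) (by linarith)
  have k6 := mul_nonneg G0 h6.le
  have k7 := mul_nonneg (mul_nonneg A0.le G0) h7.le
  have kV : 0 < ((t-q) + (s-1)*t)*(1-a+b-c+d) :=
    mul_pos (add_pos (by linarith) (mul_pos A0 (by linarith))) hV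
  linarith

/-- Homogeneous form, obtained by evaluating the quartic at `-s2/s1`. -/
lemma false_of_a2_a4_neg_a5_a7_pos {s1 s2 s3 s4 a b c d : ℝ} (p1 : 0 < s1) (p2 : 0 < s2) (p3 : 0 < s3) (p4 : 0 < s4)
    (n1 : 8*s2 ≤ 3*s1^2) (n2 : 9*(s1*s3) ≤ 4*s2^2) (n3 : 8*(s2*s4) ≤ 3*s3^2)
    (hI : 3*(s1*s3) ≤ s2^2+12*s4)
    (h7 : 0 < a - s1) (h5 : 0 < c - s1*b+s2*a-s3)
    (h4 : d - s1*c+s2*b-s3*a+s4 < 0) (h2 : s2*d-s3*c+s4*b < 0)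
    (hV : ∀ y : ℝ, 0 < y → 0 < y^4-a*y^3+b*y^2-c*y+d) : False := by
  obtain ⟨y, hy, rfl⟩ : ∃ y, 0 < y ∧ s2 = y*s1 := ⟨s2/s1, by positivity, by field_simp⟩
  replace hV := hV y hy
  obtain ⟨s, rfl⟩ : ∃ s, s1 = y*s := ⟨s1/y, by field_simp⟩
  obtain ⟨m, rfl⟩ : ∃ m, s3 = y^3*m := ⟨s3/y^3, by field_simp⟩
  obtain ⟨q, rfl⟩ : ∃ q, s4 = y^4*q := ⟨s4/y^4, by field_simp⟩
  obtain ⟨a, rfl⟩ : ∃ z, a = y*z := ⟨a/y, by field_simp⟩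
  obtain ⟨b, rfl⟩ : ∃ z, b = y^2*z := ⟨b/y^2, by field_simp⟩
  obtain ⟨c, rfl⟩ : ∃ z, c = y^3*z := ⟨c/y^3, by field_simp⟩
  obtain ⟨d, rfl⟩ : ∃ z, d = y^4*z := ⟨d/y^4, by field_simp⟩
  have hs : 0 < s := pos_of_mul_pos_right p1 hy.le
  have hm : 0 < m := pos_of_mul_pos_right p3 (by positivity)
  have hq : 0 < q := pos_of_mul_pos_right p4 (by positivity)
  have n1' : 8/3 ≤ s := by
    refine le_of_mul_le_mul_left (a := y^2*s) ?_ (by positivity); linarith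
  have n2' : 9*m ≤ 4*s := by
    refine le_of_mul_le_mul_left (a := y^4*s) ?_ (by positivity); linarith
  have n3' : 8*(s*q) ≤ 3*m^2 := by
    refine le_of_mul_le_mul_left (a := y^6) ?_ (by positivity); linarith
  refine false_of_a2_a4_neg_a5_a7_pos_of_normalized (a := a) (b := b) (c := c) (d := d) n1' hm n2' hq (by nlinarith) ?_ ?_ ?_ ?_ ?_ ?_
  · refine le_of_mul_le_mul_left (a := y^4) ?_ (by positivity); linarith
  · refine lt_of_mul_lt_mul_left (a := y) ?_ (by positivity); linarith
  · refine lt_of_mul_lt_mul_left (a := y^3) ?_ (by positivity); linarith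
  · refine lt_of_mul_lt_mul_left (a := y^4) ?_ (by positivity); linarith
  · refine lt_of_mul_lt_mul_left (a := y^6) ?_ (by positivity); linarith
  · refine lt_of_mul_lt_mul_left (a := y^4) ?_ (by positivity); linarith

/-- Homogeneous form, obtained by evaluating the quartic at `-s3/s2`. -/
lemma false_of_a4_neg_a1_a6_a7_pos {s1 s2 s3 s4 a b c d : ℝ} (p1 : 0 < s1) (p2 : 0 < s2) (p3 : 0 < s3) (p4 : 0 < s4)
    (n1 : 8*s2 ≤ 3*s1^2) (n2 : 9*(s1*s3) ≤ 4*s2^2) (n3 : 8*(s2*s4) ≤ 3*s3^2)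
    (h7 : 0 < a - s1) (h6 : 0 < b - s1*a+s2)
    (h4 : d - s1*c+s2*b-s3*a+s4 < 0) (h1 : 0 < -s3*d+s4*c)
    (hV : ∀ y : ℝ, 0 < y → 0 < y^4-a*y^3+b*y^2-c*y+d) : False := by
  obtain ⟨y, hy, rfl⟩ : ∃ y, 0 < y ∧ s3 = y*s2 := ⟨s3/s2, by positivity, by field_simp⟩
  replace hV := hV y hy
  obtain ⟨s, rfl⟩ : ∃ s, s1 = y*s := ⟨s1/y, by field_simp⟩
  obtain ⟨t, rfl⟩ : ∃ t, s2 = y^2*t := ⟨s2/y^2, by field_simp⟩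
  obtain ⟨q, rfl⟩ : ∃ q, s4 = y^4*q := ⟨s4/y^4, by field_simp⟩
  obtain ⟨a, rfl⟩ : ∃ z, a = y*z := ⟨a/y, by field_simp⟩
  obtain ⟨b, rfl⟩ : ∃ z, b = y^2*z := ⟨b/y^2, by field_simp⟩
  obtain ⟨c, rfl⟩ : ∃ z, c = y^3*z := ⟨c/y^3, by field_simp⟩
  obtain ⟨d, rfl⟩ : ∃ z, d = y^4*z := ⟨d/y^4, by field_simp⟩
  have hs : 0 < s := pos_of_mul_pos_right p1 hy.le
  have ht : 0 < t := pos_of_mul_pos_right p2 (by positivity)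
  have hq : 0 < q := pos_of_mul_pos_right p4 (by positivity)
  refine false_of_a4_neg_a1_a6_a7_pos_of_normalized (a := a) (b := b) (c := c) (d := d) (t := t) hs ?_ ?_ hq ?_ ?_ ?_ ?_ ?_ ?_
  · refine le_of_mul_le_mul_left (a := y^4*t) ?_ (by positivity); linarith
  · refine le_of_mul_le_mul_left (a := y^2) ?_ (by positivity); linarith
  · refine le_of_mul_le_mul_left (a := y^6*t) ?_ (by positivity); linarith
  · refine lt_of_mul_lt_mul_left (a := y) ?_ (by positivity); linarith
  · refine lt_of_mul_lt_mul_left (a := y^2) ?_ (by positivity); linarith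
  · refine lt_of_mul_lt_mul_left (a := y^4) ?_ (by positivity); linarith
  · refine lt_of_mul_lt_mul_left (a := y^7) ?_ (by positivity); linarith
  · refine lt_of_mul_lt_mul_left (a := y^4) ?_ (by positivity); linarith

lemma exists_monic_quartic_factor {P : ℝ[X]} (hmonic : P.Monic) (hdeg : P.degree = 8) {z : Fin 4 → ℝ}
    (hz : Function.Injective z) (h0 : ∀ i, P.eval (z i) = 0) :
    ∃ a b c d : ℝ, P = (∏ i, (X - C (z i))) * (X^4 + C a * X^3 + C b * X^2 + C c * X + C d) := by
  have hdvd : (∏ i, (X - C (z i))) ∣ P := by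
    apply Finset.prod_dvd_of_coprime
    · intro i _ j _ hij
      exact pairwise_coprime_X_sub_C hz hij
    · intro i _
      exact dvd_iff_isRoot.2 (h0 i)
  obtain ⟨V, hV⟩ := hdvd
  have hQ : (∏ i, (X - C (z i))).Monic := monic_prod_of_monic _ _ fun i _ => monic_X_sub_C _
  have hVm : V.Monic := hQ.of_mul_monic_left (hV ▸ hmonic)
  have hVd : V.natDegree = 4 := by
    have h1 := congrArg natDegree hV
    rw [hQ.natDegree_mul hVm, natDegree_prod_of_monic _ _ fun i _ => monic_X_sub_C _,
      natDegree_eq_of_degree_eq_some (n := 8) hdeg] at h1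
    simp at h1
    omega
  refine ⟨V.coeff 3, V.coeff 2, V.coeff 1, V.coeff 0, ?_⟩
  have h4 : V.coeff 4 = 1 := hVd ▸ hVm.coeff_natDegree
  have hVe := V.as_sum_range_C_mul_X_pow
  rw [hVd] at hVe
  simp only [Finset.sum_range_succ, Finset.sum_range_zero, h4] at hVe
  rw [hV]
  congr 1
  conv_lhs => rw [hVe]
  simp only [map_one, pow_zero, pow_one]
  ring

lemma quartic_mul_expand (p q r s a b c d : ℝ) :
    (X - C p) * (X - C q) * (X - C r) * (X - C s) *
      (X^4 + C a * X^3 + C b * X^2 + C c * X + C d) =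
    let s1 := p+q+r+s
    let s2 := p*q+p*r+p*s+q*r+q*s+r*s
    let s3 := p*q*r+p*q*s+p*r*s+q*r*s
    let s4 := p*q*r*s
    X^8 + C (a-s1) * X^7 + C (b-s1*a+s2) * X^6 + C (c - s1*b+s2*a-s3) * X^5
      + C (d-s1*c+s2*b-s3*a+s4) * X^4 + C (-s1*d+s2*c-s3*b+s4*a) * X^3
      + C (s2*d-s3*c+s4*b) * X^2 + C (-s3*d+s4*c) * X + C (s4*d) := by
  simp only [map_add, map_mul, map_sub, map_neg]
  ring

lemma eval_pos_of_neg {P : ℝ[X]} (hP : 0 < P.coeff 0) (hneg : ∀ x : ℝ, x < 0 → P.eval x ≠ 0) {x : ℝ}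
    (hx : x < 0) : 0 < P.eval x := by
  by_contra! h
  have h0 : 0 ≤ P.eval 0 := by rw [← coeff_zero_eq_eval_zero]; exact hP.le
  obtain ⟨w, hw, hw0⟩ := intermediate_value_Icc hx.le P.continuous.continuousOn ⟨h, h0⟩
  rcases hw.2.lt_or_eq with h1 | rfl
  · exact hneg w h1 hw0
  · rw [coeff_zero_eq_eval_zero] at hP
    exact hP.ne' hw0

lemma sign_pos_iff {x : ℝ} : Real.sign x = 1 ↔ 0 < x := by
  rcases lt_trichotomy x 0 with h | rfl | h
  · norm_num [Real.sign_of_neg h, h.le]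
  · simp
  · simp [Real.sign_of_pos h, h]

lemma sign_neg_iff {x : ℝ} : Real.sign x = -1 ↔ x < 0 := by
  rw [← neg_pos, ← sign_pos_iff, Real.sign_neg, neg_eq_iff_eq_neg]

lemma coeff_octic (a₀ a₁ a₂ a₃ a₄ a₅ a₆ a₇ : ℝ) {P : ℝ[X]}
    (hP : P = X^8 + C a₇ * X^7 + C a₆ * X^6 + C a₅ * X^5 + C a₄ * X^4 + C a₃ * X^3
      + C a₂ * X^2 + C a₁ * X + C a₀) :
    P.coeff 7 = a₇ ∧ P.coeff 6 = a₆ ∧ P.coeff 5 = a₅ ∧ P.coeff 4 = a₄ ∧ P.coeff 2 = a₂ ∧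
      P.coeff 1 = a₁ := by
  subst hP
  simp [coeff_X_pow, coeff_C]

/-- None of the five sign patterns is realized by a monic polynomial of degree 8 with four distinct
positive roots and no negative root. -/
lemma not_definesSignPattern_of_four_roots {σ : Fin 9 → ℝ}
    (hσ : σ = ![1, 1, -1, 1, -1, -1, -1, 1, 1] ∨
          σ = ![1, 1, -1, 1, -1, 1, -1, -1, 1] ∨
          σ = ![1, 1, 1, -1, -1, 1, -1, 1, 1] ∨
          σ = ![1, 1, 1, 1, -1, 1, -1, -1, 1] ∨
          σ = ![1, 1, -1, 1, -1, -1, -1, -1, 1])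
    {P : ℝ[X]} (hmonic : P.Monic) (hdeg : P.degree = 8)
    (hneg : ∀ x : ℝ, x < 0 → P.eval x ≠ 0) {z : Fin 4 → ℝ} (hz : Function.Injective z)
    (hpos : ∀ i, 0 < z i) (h0 : ∀ i, P.eval (z i) = 0) : ¬ definesSignPattern P σ := by
  intro hpat
  obtain ⟨a, b, c, d, hP⟩ := exists_monic_quartic_factor hmonic hdeg hz h0
  rw [Fin.prod_univ_four] at hP
  have hV : 0 < P.coeff 0 → ∀ y : ℝ, 0 < y → 0 < y^4-a*y^3+b*y^2-c*y+d := by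
    intro hc y hy
    have h := eval_pos_of_neg hc hneg (neg_lt_zero.2 hy)
    rw [hP] at h
    simp only [eval_mul, eval_add, eval_sub, eval_pow, eval_X, eval_C] at h
    have hq : 0 < (y + z 0) * (y + z 1) * (y + z 2) * (y + z 3) := by
      have := hpos 0; have := hpos 1; have := hpos 2; have := hpos 3
      positivity
    refine pos_of_mul_pos_right (a := (y + z 0) * (y + z 1) * (y + z 2) * (y + z 3)) ?_ hq.le
    linarith
  have p0 := hpos 0
  have p1 := hpos 1
  have p2 := hpos 2
  have p3 := hpos 3
  rw [quartic_mul_expand] at hP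
  have n1 := eight_esymm_two_le (z 0) (z 1) (z 2) (z 3)
  have n2 := nine_esymm_one_mul_three_le (z 0) (z 1) (z 2) (z 3)
  have n3 := eight_esymm_two_mul_four_le (z 0) (z 1) (z 2) (z 3)
  have hI := three_esymm_one_mul_three_le (z 0) (z 1) (z 2) (z 3)
  generalize z 0 = p, z 1 = q, z 2 = r, z 3 = s at *
  have e1 : 0 < p+q+r+s := by positivity
  have e2 : 0 < p*q+p*r+p*s+q*r+q*s+r*s := by positivity
  have e3 : 0 < p*q*r+p*q*s+p*r*s+q*r*s := by positivity
  have e4 : 0 < p*q*r*s := by positivity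
  obtain ⟨c7, c6, c5, c4, c2, c1⟩ := coeff_octic _ _ _ _ _ _ _ _ hP
  clear hP
  have k1 := hpat 1
  have k2 := hpat 2
  have k3 := hpat 3
  have k4 := hpat 4
  have k6 := hpat 6
  have k7 := hpat 7
  have k8 := hpat 8
  rcases hσ with rfl | rfl | rfl | rfl | rfl
  all_goals
    simp [sign_pos_iff, sign_neg_iff] at k1 k2 k3 k4 k6 k7 k8
    replace hV := hV k8
    rw [c7] at k1
    rw [c6] at k2
    rw [c5] at k3
    rw [c4] at k4
    rw [c2] at k6
    rw [c1] at k7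
    first
    | exact false_of_a2_a4_neg_a5_a7_pos e1 e2 e3 e4 n1 n2 n3 hI k1 k3 k4 k6 hV
    | exact false_of_a4_neg_a1_a6_a7_pos e1 e2 e3 e4 n1 n2 n3 k1 k2 k4 k7 hV

/-- If one of the five listed sign patterns is realized by a monic degree 8
polynomial with no negative real roots and exactly four simple positive real
roots, then it is realized by a monic degree 8 polynomial of the form
`(x−1)⁴ V(x)` with `V` monic of degree 4 without real roots. -/
theorem stmt11 (σ : Fin 9 → ℝ)
    (hσ : σ = ![1, 1, -1, 1, -1, -1, -1, 1, 1] ∨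
          σ = ![1, 1, -1, 1, -1, 1, -1, -1, 1] ∨
          σ = ![1, 1, 1, -1, -1, 1, -1, 1, 1] ∨
          σ = ![1, 1, 1, 1, -1, 1, -1, -1, 1] ∨
          σ = ![1, 1, -1, 1, -1, -1, -1, -1, 1])
    (P : Polynomial ℝ) (hmonic : P.Monic) (hdeg : P.degree = 8)
    (hpat : definesSignPattern P σ)
    (hneg : ∀ x : ℝ, x < 0 → P.eval x ≠ 0)
    (hpos : ∃ z : Fin 4 → ℝ, StrictMono z ∧ (∀ i, 0 < z i) ∧
      (∀ i, P.eval (z i) = 0) ∧ (∀ i, P.rootMultiplicity (z i) = 1) ∧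
      (∀ x : ℝ, 0 < x → P.eval x = 0 → ∃ i, x = z i)) :
    ∃ V : Polynomial ℝ, V.Monic ∧ V.degree = 4 ∧ (∀ x : ℝ, V.eval x ≠ 0) ∧
      definesSignPattern ((X - 1) ^ 4 * V) σ := by
  obtain ⟨z, hz, hz0, hzP, -, -⟩ := hpos
  exact absurd hpat
    (not_definesSignPattern_of_four_roots hσ hmonic hdeg hneg hz.injective hz0 hzP)
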